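/- Let q ∈ ℝ with q ≠ 0. Then for every x, y, ρ ∈ ℝ and every integer n ≥ 0: p_n(x|y,ρ,q) = Σ_{j=0}^{n} [n choose j]_q · ρ^{n−j} · h_j(x|q) · b_{n−j}(y|q). -/

import Mathlib

open Finset

section Defs

variable {K : Type*} [Field K]

/-- q-Pochhammer symbol `(a; q)_n = ∏_{j=0}^{n-1} (1 - a q^j)`. -/
def qPoch (a q : K) (n : ℕ) : K := ∏ j ∈ Finset.range n, (1 - a * q ^ j)

/-- Gaussian (q-binomial) coefficient `[n choose k]_q`. -/
def qBinom (q : K) : ℕ → ℕ → K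
  | _, 0 => 1
  | 0, _ + 1 => 0
  | n + 1, k + 1 => qBinom q n k + q ^ (k + 1) * qBinom q n (k + 1)

/-- Continuous q-Hermite polynomials `h_n(x|q)`:
`h_{-1} = 0`, `h_0 = 1`, `h_{n+1} = 2x h_n - (1 - q^n) h_{n-1}`. -/
def hQH (q x : K) : ℕ → K
  | 0 => 1
  | 1 => 2 * x
  | n + 2 => 2 * x * hQH q x (n + 1) - (1 - q ^ (n + 1)) * hQH q x n

/-- The polynomials `b_n(x|q) = (-1)^n q^{n(n-1)/2} h_n(x|q^{-1})` (for `q ≠ 0`). -/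
def bQH (q x : K) (n : ℕ) : K := (-1) ^ n * q ^ (n * (n - 1) / 2) * hQH q⁻¹ x n

/-- Al-Salam–Chihara polynomials in conjugate-pair parametrization `p_n(x|y,ρ,q)`:
`p_{-1} = 0`, `p_0 = 1`,
`p_{n+1} = 2(x - ρ y q^n) p_n - (1 - q^n)(1 - ρ² q^{n-1}) p_{n-1}`. -/
def pASC (q x y ρ : K) : ℕ → K
  | 0 => 1
  | 1 => 2 * (x - ρ * y)
  | n + 2 => 2 * (x - ρ * y * q ^ (n + 1)) * pASC q x y ρ (n + 1)
      - (1 - q ^ (n + 1)) * (1 - ρ ^ 2 * q ^ n) * pASC q x y ρ n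

open Classical in
/-- The polynomials `g_n(x|y,ρ,q)`: `ρ^n p_n(y|x,ρ⁻¹,q)` for `ρ ≠ 0`, `b_n(x|q)` for `ρ = 0`. -/
noncomputable def gASC (q x y ρ : K) (n : ℕ) : K :=
  if ρ = 0 then bQH q x n else ρ ^ n * pASC q y x ρ⁻¹ n

/-- `ω(u,v|ρ) = (1-ρ²)² - 4uvρ(1+ρ²) + 4ρ²(u²+v²)`. -/
def omegaW (u v ρ : K) : K :=
  (1 - ρ ^ 2) ^ 2 - 4 * u * v * ρ * (1 + ρ ^ 2) + 4 * ρ ^ 2 * (u ^ 2 + v ^ 2)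

/-- `v(x|t) = 1 - 2xt + t²`. -/
def vQH (x t : K) : K := 1 - 2 * x * t + t ^ 2

/-- Coefficient `e_n(a,b,c,d,q)` of the Askey–Wilson three-term recurrence. -/
def eAW (a b c d q : K) (n : ℕ) : K :=
  q ^ ((n : ℤ) - 2) /
      ((1 - a * b * c * d * q ^ (2 * (n : ℤ) - 2)) * (1 - a * b * c * d * q ^ (2 * (n : ℤ)))) *
    ((a + b + c + d) * (q ^ 2 - a * b * c * d * q ^ (n : ℤ) * (1 + q - q ^ ((n : ℤ) + 1))) +
      (a * b * c + a * b * d + a * c * d + b * c * d) *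
        (q - q ^ ((n : ℤ) + 2) - q ^ ((n : ℤ) + 1) + a * b * c * d * q ^ (2 * (n : ℤ))))

/-- Coefficient `f_n(a,b,c,d,q)` of the Askey–Wilson three-term recurrence. -/
def fAW (a b c d q : K) (n : ℕ) : K :=
  (1 - q ^ (n : ℤ)) * (1 - a * b * q ^ ((n : ℤ) - 1)) * (1 - a * c * q ^ ((n : ℤ) - 1)) *
      (1 - a * d * q ^ ((n : ℤ) - 1)) * (1 - b * c * q ^ ((n : ℤ) - 1)) *
      (1 - b * d * q ^ ((n : ℤ) - 1)) * (1 - c * d * q ^ ((n : ℤ) - 1)) *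
      (1 - a * b * c * d * q ^ ((n : ℤ) - 2)) /
    (qPoch (a * b * c * d * q ^ (2 * (n : ℤ) - 3)) q 3 *
      (1 - a * b * c * d * q ^ (2 * (n : ℤ) - 2)))

/-- Monic Askey–Wilson polynomials `α_n(x|a,b,c,d,q)`:
`α_{-1} = 0`, `α_0 = 1`, `α_{n+1} = (2x - e_n) α_n - f_n α_{n-1}`. -/
def alphaAW (a b c d q x : K) : ℕ → K
  | 0 => 1
  | 1 => 2 * x - eAW a b c d q 0
  | n + 2 => (2 * x - eAW a b c d q (n + 1)) * alphaAW a b c d q x (n + 1) -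
      fAW a b c d q (n + 1) * alphaAW a b c d q x n

/-- Coefficient of `ψ_n` in the continuous dual Hahn recurrence:
`q^n (b+c+d) + bcd q^{n-1} (1 - q^{n+1} - q^n)`. -/
def ePsi (b c d q : K) (n : ℕ) : K :=
  q ^ (n : ℤ) * (b + c + d) + b * c * d * q ^ ((n : ℤ) - 1) * (1 - q ^ ((n : ℤ) + 1) - q ^ (n : ℤ))

/-- Coefficient of `ψ_{n-1}` in the continuous dual Hahn recurrence:
`(1-q^n)(1-bcq^{n-1})(1-bdq^{n-1})(1-cdq^{n-1})`. -/
def fPsi (b c d q : K) (n : ℕ) : K :=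
  (1 - q ^ (n : ℤ)) * (1 - b * c * q ^ ((n : ℤ) - 1)) * (1 - b * d * q ^ ((n : ℤ) - 1)) *
    (1 - c * d * q ^ ((n : ℤ) - 1))

/-- Continuous dual Hahn polynomials `ψ_n(x|b,c,d,q)`:
`ψ_{-1} = 0`, `ψ_0 = 1`, `ψ_{n+1} = (2x - ePsi_n) ψ_n - fPsi_n ψ_{n-1}`. -/
def psiCDH (b c d q x : K) : ℕ → K
  | 0 => 1
  | 1 => 2 * x - ePsi b c d q 0
  | n + 2 => (2 * x - ePsi b c d q (n + 1)) * psiCDH b c d q x (n + 1) -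
      fPsi b c d q (n + 1) * psiCDH b c d q x n

/-- Al-Salam–Chihara polynomials `Q_n(x|c,d,q)`:
`Q_{-1} = 0`, `Q_0 = 1`, `Q_{n+1} = (2x - q^n(c+d)) Q_n - (1-q^n)(1-cdq^{n-1}) Q_{n-1}`. -/
def qASC (c d q x : K) : ℕ → K
  | 0 => 1
  | 1 => 2 * x - (c + d)
  | n + 2 => (2 * x - q ^ (n + 1) * (c + d)) * qASC c d q x (n + 1) -
      (1 - q ^ (n + 1)) * (1 - c * d * q ^ n) * qASC c d q x n

/-- Coefficient `ẽ_n` of the conjugate-pair Askey–Wilson recurrence. -/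
def eW (y ρ₁ z ρ₂ q : K) (n : ℕ) : K :=
  2 * q ^ ((n : ℤ) - 1) /
      ((1 - ρ₁ ^ 2 * ρ₂ ^ 2 * q ^ (2 * (n : ℤ) - 2)) *
        (1 - ρ₁ ^ 2 * ρ₂ ^ 2 * q ^ (2 * (n : ℤ)))) *
    (q * (ρ₁ * y + ρ₂ * z) *
        (1 - ρ₁ ^ 2 * ρ₂ ^ 2 * q ^ ((n : ℤ) - 2) * (1 + q - q ^ ((n : ℤ) + 1))) +
      ρ₁ * ρ₂ * (ρ₁ * z + ρ₂ * y) *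
        (1 - q ^ ((n : ℤ) + 1) - q ^ (n : ℤ) + ρ₁ ^ 2 * ρ₂ ^ 2 * q ^ (2 * (n : ℤ) - 1)))

/-- Coefficient `f̃_n` of the conjugate-pair Askey–Wilson recurrence. -/
def fW (y ρ₁ z ρ₂ q : K) (n : ℕ) : K :=
  (1 - q ^ (n : ℤ)) * omegaW y z (ρ₁ * ρ₂ * q ^ ((n : ℤ) - 1)) *
      (1 - ρ₁ ^ 2 * q ^ ((n : ℤ) - 1)) * (1 - ρ₂ ^ 2 * q ^ ((n : ℤ) - 1)) *
      (1 - ρ₁ ^ 2 * ρ₂ ^ 2 * q ^ ((n : ℤ) - 2)) /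
    (qPoch (ρ₁ ^ 2 * ρ₂ ^ 2 * q ^ (2 * (n : ℤ) - 3)) q 3 *
      (1 - ρ₁ ^ 2 * ρ₂ ^ 2 * q ^ (2 * (n : ℤ) - 2)))

/-- Conjugate-pair Askey–Wilson polynomials `w_n(x|y,ρ₁,z,ρ₂,q)`:
`w_{-1} = 0`, `w_0 = 1`, `w_{n+1} = (2x - ẽ_n) w_n - f̃_n w_{n-1}`. -/
def wAW (x y ρ₁ z ρ₂ q : K) : ℕ → K
  | 0 => 1
  | 1 => 2 * x - eW y ρ₁ z ρ₂ q 0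
  | n + 2 => (2 * x - eW y ρ₁ z ρ₂ q (n + 1)) * wAW x y ρ₁ z ρ₂ q (n + 1) -
      fW y ρ₁ z ρ₂ q (n + 1) * wAW x y ρ₁ z ρ₂ q n

/-- Chebyshev polynomials of the second kind. -/
def chebU (x : K) : ℕ → K
  | 0 => 1
  | 1 => 2 * x
  | n + 2 => 2 * x * chebU x (n + 1) - chebU x n

/-- The quantity `A_n` from the Askey–Wilson recurrence factorization. -/
def A_AW (a b c d q : K) (n : ℕ) : K :=
  (1 - a * b * q ^ (n : ℤ)) * (1 - a * c * q ^ (n : ℤ)) * (1 - a * d * q ^ (n : ℤ)) *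
      (1 - a * b * c * d * q ^ ((n : ℤ) - 1)) /
    (a * (1 - a * b * c * d * q ^ (2 * (n : ℤ) - 1)) * (1 - a * b * c * d * q ^ (2 * (n : ℤ))))

/-- The quantity `C_n` from the Askey–Wilson recurrence factorization. -/
def C_AW (a b c d q : K) (n : ℕ) : K :=
  a * (1 - q ^ (n : ℤ)) * (1 - b * c * q ^ ((n : ℤ) - 1)) * (1 - b * d * q ^ ((n : ℤ) - 1)) *
      (1 - c * d * q ^ ((n : ℤ) - 1)) /
    ((1 - a * b * c * d * q ^ (2 * (n : ℤ) - 2)) * (1 - a * b * c * d * q ^ (2 * (n : ℤ) - 1)))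

end Defs

section QBinom

variable {K : Type*} [Field K]

theorem qBinom_zero_right (q : K) (n : ℕ) : qBinom q n 0 = 1 := by
  cases n <;> rfl

theorem qBinom_succ_succ (q : K) (n k : ℕ) :
    qBinom q (n + 1) (k + 1) = qBinom q n k + q ^ (k + 1) * qBinom q n (k + 1) := rfl

theorem qBinom_eq_zero_of_lt (q : K) {n k : ℕ} (h : n < k) : qBinom q n k = 0 := by
  induction n generalizing k with
  | zero => obtain ⟨k, rfl⟩ := Nat.exists_eq_succ_of_ne_zero h.ne'; rfl
  | succ n ih =>
    obtain ⟨k, rfl⟩ := Nat.exists_eq_succ_of_ne_zero (Nat.ne_zero_of_lt h)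
    rw [Nat.succ_eq_add_one, qBinom_succ_succ, ih (by omega), ih (by omega)]
    ring

theorem qBinom_succ_right_mul (q : K) (n j : ℕ) :
    q ^ j * (qBinom q n (j + 1) * (1 - q ^ (j + 1))) = (q ^ j - q ^ n) * qBinom q n j := by
  induction n generalizing j with
  | zero => cases j <;> simp [qBinom]
  | succ n ih =>
    cases j with
    | zero =>
      have h := ih 0
      simp only [qBinom_succ_succ, qBinom_zero_right] at h ⊢
      linear_combination q * h
    | succ j =>
      have h₁ := ih j
      have h₂ := ih (j + 1)
      rw [qBinom_succ_succ, qBinom_succ_succ]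
      linear_combination q ^ (j + 2) * h₂ + q * h₁

theorem qBinom_succ_succ_mul (q : K) (n j : ℕ) :
    qBinom q (n + 1) (j + 1) * (1 - q ^ (j + 1)) = (1 - q ^ (n + 1)) * qBinom q n j := by
  rw [qBinom_succ_succ]
  linear_combination q * qBinom_succ_right_mul q n j

theorem qBinom_succ_left_mul {q : K} (hq : q ≠ 0) (j k : ℕ) :
    qBinom q (j + k + 1) j * (1 - q ^ (k + 1)) =
      (1 - q ^ (j + k + 1)) * qBinom q (j + k) j := by
  refine mul_left_cancel₀ (pow_ne_zero j hq) ?_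
  linear_combination q ^ j * qBinom_succ_succ_mul q (j + k) j -
    qBinom_succ_right_mul q (j + k + 1) j

theorem sum_antidiagonal_succ_qBinom_mul (q : K) (F : ℕ → ℕ → K) (n : ℕ) :
    ∑ p ∈ antidiagonal (n + 1), qBinom q (n + 1) p.1 * F p.1 p.2 =
      ∑ p ∈ antidiagonal n, qBinom q n p.1 * (F (p.1 + 1) p.2 + q ^ p.1 * F p.1 (p.2 + 1)) := by
  have h := (Nat.sum_antidiagonal_succ' (n := n)
      (f := fun p => qBinom q n p.1 * q ^ p.1 * F p.1 p.2)).symm.trans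
    Nat.sum_antidiagonal_succ
  simp only [qBinom_eq_zero_of_lt q n.lt_succ_self, qBinom_zero_right] at h
  simp only [Nat.sum_antidiagonal_succ, qBinom_zero_right, qBinom_succ_succ, mul_add, add_mul,
    sum_add_distrib]
  simp only [mul_assoc, mul_left_comm] at h ⊢
  linear_combination -h

end QBinom

section QHermite

variable {K : Type*} [Field K]

theorem two_mul_hQH_succ_sub (q x : K) (n : ℕ) :
    2 * x * hQH q x (n + 1) - hQH q x (n + 2) = (1 - q ^ (n + 1)) * hQH q x n := by
  rw [hQH]; ring

theorem bQH_zero (q y : K) : bQH q y 0 = 1 := by simp [bQH, hQH]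

theorem bQH_one (q y : K) : bQH q y 1 = -(2 * y) := by simp [bQH, hQH]

theorem bQH_add_two {q : K} (hq : q ≠ 0) (y : K) (n : ℕ) :
    bQH q y (n + 2) =
      -(2 * y * q ^ (n + 1) * bQH q y (n + 1)) + q ^ n * (1 - q ^ (n + 1)) * bQH q y n := by
  have e (m : ℕ) : (m + 1) * (m + 1 - 1) / 2 = m * (m - 1) / 2 + m := by
    rw [← Nat.choose_two_right, ← Nat.choose_two_right, Nat.choose_succ_succ', Nat.choose_one_right,
      add_comm]
  have hinv : q ^ (n + 1) * q⁻¹ ^ (n + 1) = 1 := by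
    rw [← mul_pow, mul_inv_cancel₀ hq, one_pow]
  simp only [bQH, hQH, e (n + 1), e n]
  linear_combination (-1) ^ n * q ^ (n * (n - 1) / 2) * q ^ n * hQH q⁻¹ y n * hinv

end QHermite

/-- The convolution `∑ [n choose j]_q ρ^{n-j} h_j(x|q) b_{n-j}(y|q)` satisfies the three-term
recurrence of the Al-Salam–Chihara polynomials. -/
theorem sum_antidiagonal_hQH_bQH_add_two {K : Type*} [Field K] {q : K} (hq : q ≠ 0)
    (x y ρ : K) (n : ℕ) :
    ∑ p ∈ antidiagonal (n + 2),
        qBinom q (n + 2) p.1 * (hQH q x p.1 * (ρ ^ p.2 * bQH q y p.2)) =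
      2 * (x - ρ * y * q ^ (n + 1)) * ∑ p ∈ antidiagonal (n + 1),
          qBinom q (n + 1) p.1 * (hQH q x p.1 * (ρ ^ p.2 * bQH q y p.2)) -
        (1 - q ^ (n + 1)) * (1 - ρ ^ 2 * q ^ n) * ∑ p ∈ antidiagonal n,
          qBinom q n p.1 * (hQH q x p.1 * (ρ ^ p.2 * bQH q y p.2)) := by
  have hx : ∑ p ∈ antidiagonal (n + 1), qBinom q (n + 1) p.1 *
        ((2 * x * hQH q x p.1 - hQH q x (p.1 + 1)) * (ρ ^ p.2 * bQH q y p.2)) =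
      (1 - q ^ (n + 1)) * ∑ p ∈ antidiagonal n,
          qBinom q n p.1 * (hQH q x p.1 * (ρ ^ p.2 * bQH q y p.2)) := by
    have h0 : 2 * x * hQH q x 0 - hQH q x (0 + 1) = 0 := by simp [hQH]
    rw [Nat.sum_antidiagonal_succ, h0, zero_mul, mul_zero, zero_add, mul_sum]
    refine sum_congr rfl fun p _ => ?_
    rw [two_mul_hQH_succ_sub]
    linear_combination
      hQH q x p.1 * (ρ ^ p.2 * bQH q y p.2) * qBinom_succ_succ_mul q n p.1
  have hy : ∑ p ∈ antidiagonal (n + 1), qBinom q (n + 1) p.1 * (hQH q x p.1 *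
        (q ^ p.1 * (ρ ^ (p.2 + 1) * bQH q y (p.2 + 1)) +
          2 * ρ * y * q ^ (n + 1) * (ρ ^ p.2 * bQH q y p.2))) =
      (1 - q ^ (n + 1)) * (ρ ^ 2 * q ^ n) * ∑ p ∈ antidiagonal n,
          qBinom q n p.1 * (hQH q x p.1 * (ρ ^ p.2 * bQH q y p.2)) := by
    have h0 : q ^ (n + 1) * (ρ ^ (0 + 1) * bQH q y (0 + 1)) +
        2 * ρ * y * q ^ (n + 1) * (ρ ^ 0 * bQH q y 0) = 0 := by
      rw [zero_add, bQH_one, bQH_zero]; ring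
    rw [Nat.sum_antidiagonal_succ', h0, mul_zero, mul_zero, zero_add, mul_sum]
    refine sum_congr rfl fun p hp => ?_
    obtain ⟨j, k⟩ := p
    obtain rfl : j + k = n := mem_antidiagonal.mp hp
    simp only [bQH_add_two hq]
    linear_combination q ^ (j + k) * ρ ^ (k + 2) * hQH q x j * bQH q y k *
      qBinom_succ_left_mul hq j k
  have hsplit := sum_antidiagonal_succ_qBinom_mul q
    (fun j k => hQH q x j * (ρ ^ k * bQH q y k)) (n + 1)
  have hsum : ∑ p ∈ antidiagonal (n + 1), qBinom q (n + 1) p.1 *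
        (hQH q x (p.1 + 1) * (ρ ^ p.2 * bQH q y p.2) +
          q ^ p.1 * (hQH q x p.1 * (ρ ^ (p.2 + 1) * bQH q y (p.2 + 1)))) =
      2 * (x - ρ * y * q ^ (n + 1)) * ∑ p ∈ antidiagonal (n + 1),
          qBinom q (n + 1) p.1 * (hQH q x p.1 * (ρ ^ p.2 * bQH q y p.2)) -
        ∑ p ∈ antidiagonal (n + 1), qBinom q (n + 1) p.1 *
          ((2 * x * hQH q x p.1 - hQH q x (p.1 + 1)) * (ρ ^ p.2 * bQH q y p.2)) +
        ∑ p ∈ antidiagonal (n + 1), qBinom q (n + 1) p.1 * (hQH q x p.1 *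
          (q ^ p.1 * (ρ ^ (p.2 + 1) * bQH q y (p.2 + 1)) +
            2 * ρ * y * q ^ (n + 1) * (ρ ^ p.2 * bQH q y p.2))) := by
    rw [mul_sum, ← sum_sub_distrib, ← sum_add_distrib]
    exact sum_congr rfl fun p _ => by ring
  linear_combination hsplit + hsum - hx + hy

/-- Lemma: `p_n(x|y,ρ,q) = ∑_{j=0}^n [n choose j]_q ρ^{n-j} h_j(x|q) b_{n-j}(y|q)`. -/
theorem pASC_expansion_h_b (q : ℝ) (hq : q ≠ 0) (x y ρ : ℝ) (n : ℕ) :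
    pASC q x y ρ n =
      ∑ j ∈ Finset.range (n + 1),
        qBinom q n j * ρ ^ (n - j) * hQH q x j * bQH q y (n - j) := by
  trans ∑ p ∈ antidiagonal n, qBinom q n p.1 * (hQH q x p.1 * (ρ ^ p.2 * bQH q y p.2))
  · induction n using Nat.twoStepInduction with
    | zero => simp [pASC, qBinom, hQH, bQH_zero]
    | one =>
      simp [pASC, qBinom, hQH, bQH_zero, bQH_one, Nat.sum_antidiagonal_succ]
      ring
    | more n ih₀ ih₁ => rw [sum_antidiagonal_hQH_bQH_add_two hq, pASC, ih₀, ih₁]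
  · rw [Nat.sum_antidiagonal_eq_sum_range_succ_mk]
    exact sum_congr rfl fun j _ => by ring
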